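/- arXiv:1401.5651 — 4 statements merged into one kernel-verified Lean document; each statement's English description precedes it below -/
import Mathlib

section
/- Let d ≥ 2, let 0 = a_0 < a_1 < ... < a_n = L and let p : [0,L] → ℝ^d be the arc-length parametrization of a polygonal arc with vertices p(a_0), ..., p(a_n) (so p is affine on each segment [a_{k-1}, a_k] with |p'| = 1 there). Let K > 0 satisfy K·L ≤ π, and suppose that at every interior vertex the exterior angle φ_i = ∠(p(a_i) − p(a_{i−1}), p(a_{i+1}) − p(a_i)) satisfies φ_i ≤ K·(ℓ_i + ℓ_{i+1})/2, where ℓ_j = a_j − a_{j−1} (i.e. the discrete curvature κ_{d,2} of p is at most K). Then (2/K)·sin(K·L/2) < |p(L) − p(0)|; that is, the endpoint distance of p is strictly larger than the endpoint distance |η(L) − η(0)| of an arc-length parametrized circular arc η of curvature K and length L. -/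
open Finset in
/-- If the angles between unit vectors `u k` are at most the differences of planar angles `θ k`,
the weighted sum of the `u k` is at least as long as the projection of the planar sum. -/
theorem sum_mul_cos_le_norm_sum_smul {E : Type*} [NormedAddCommGroup E] [InnerProductSpace ℝ E]
    (s : Finset ℕ) (w θ : ℕ → ℝ) (u : ℕ → E) (hw : ∀ k ∈ s, 0 ≤ w k) (hu : ∀ k ∈ s, ‖u k‖ = 1)
    (hθ : ∀ i ∈ s, ∀ j ∈ s, |θ i - θ j| ≤ Real.pi)
    (hangle : ∀ i ∈ s, ∀ j ∈ s, InnerProductGeometry.angle (u i) (u j) ≤ |θ i - θ j|) :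
    ∑ k ∈ s, w k * Real.cos (θ k) ≤ ‖∑ k ∈ s, w k • u k‖ := by
  have hsq : (∑ k ∈ s, w k * Real.cos (θ k)) ^ 2 + (∑ k ∈ s, w k * Real.sin (θ k)) ^ 2
      ≤ ‖∑ k ∈ s, w k • u k‖ ^ 2 := by
    rw [← real_inner_self_eq_norm_sq, sum_inner, sq, sq, sum_mul_sum, sum_mul_sum,
      ← sum_add_distrib]
    refine sum_le_sum fun i hi => ?_
    rw [inner_sum, ← sum_add_distrib]
    refine sum_le_sum fun j hj => ?_
    have hinner : Real.cos (θ i - θ j) ≤ inner ℝ (u i) (u j) := by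
      rw [← InnerProductGeometry.cos_angle_mul_norm_mul_norm, hu i hi, hu j hj, mul_one, mul_one,
        ← Real.cos_abs (θ i - θ j)]
      exact Real.cos_le_cos_of_nonneg_of_le_pi (InnerProductGeometry.angle_nonneg _ _)
        (hθ i hi j hj) (hangle i hi j hj)
    have h := mul_le_mul_of_nonneg_left hinner (mul_nonneg (hw i hi) (hw j hj))
    rw [Real.cos_sub] at h
    rw [real_inner_smul_left, real_inner_smul_right]
    linarith
  exact (abs_le_of_sq_le_sq' (by linarith [sq_nonneg (∑ k ∈ s, w k * Real.sin (θ k))])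
    (norm_nonneg _)).2

/-- Angles along a chain of nonzero vectors add up. -/
theorem angle_le_sub_of_angle_succ_le {E : Type*} [NormedAddCommGroup E] [InnerProductSpace ℝ E]
    {n : ℕ} {θ : ℕ → ℝ} {u : ℕ → E} (hu : ∀ k < n, u k ≠ 0)
    (h : ∀ k, k + 1 < n → InnerProductGeometry.angle (u k) (u (k + 1)) ≤ θ (k + 1) - θ k)
    {i j : ℕ} (hij : i ≤ j) (hj : j < n) :
    InnerProductGeometry.angle (u i) (u j) ≤ θ j - θ i := by
  induction j, hij using Nat.le_induction with
  | base => simp [InnerProductGeometry.angle_self (hu i hj)]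
  | succ j hij ih =>
    have := InnerProductGeometry.angle_le_angle_add_angle (u i) (u j) (u (j + 1))
    linarith [ih (by omega), h j hj]

/-- On `[-π / 2, π / 2]` an increment of the sine is less than its midpoint-rule approximation. -/
theorem sin_sub_sin_lt {x y : ℝ} (hxy : x < y) (hx : -(Real.pi / 2) ≤ x) (hy : y ≤ Real.pi / 2) :
    Real.sin y - Real.sin x < (y - x) * Real.cos ((x + y) / 2) := by
  have hcos : 0 < Real.cos ((x + y) / 2) :=
    Real.cos_pos_of_mem_Ioo ⟨by linarith, by linarith⟩
  have hsin : Real.sin ((y - x) / 2) < (y - x) / 2 := Real.sin_lt (by linarith)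
  rw [Real.sin_sub_sin, add_comm y x]
  nlinarith

/-- **Schur's Comparison Theorem for polygonal arcs** (Proposition 3 / Proposition `schurtheorem`).
Let `p : [0, L] → ℝ^d` be the arc-length parametrization of a polygonal arc with vertices
`p (a 0), …, p (a n)`, where `0 = a 0 < a 1 < … < a n = L`; so on each segment
`[a k, a (k+1)]` the map `p` is affine with unit direction `u k`.  Assume `K > 0`,
`K * L ≤ π`, and that the exterior angle at every interior vertex satisfies
`φ_i ≤ K * (ℓ_i + ℓ_{i+1}) / 2` (i.e. `κ_{d,2}(p) ≤ K`).  Then the endpoint distance of the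
arc-length circular arc of curvature `K` and length `L`, which is `(2/K) * sin (K*L/2)`,
is strictly smaller than the endpoint distance `|p L - p 0|`. -/
theorem schur_comparison_for_polygons
    (d n : ℕ) (hd : 2 ≤ d) (hn : 1 ≤ n)
    (L K : ℝ) (hK : 0 < K) (hKL : K * L ≤ Real.pi)
    (a : ℕ → ℝ) (ha0 : a 0 = 0) (han : a n = L)
    (hmono : ∀ k < n, a k < a (k + 1))
    (p : ℝ → EuclideanSpace ℝ (Fin d)) (u : ℕ → EuclideanSpace ℝ (Fin d))
    (hu : ∀ k < n, ‖u k‖ = 1)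
    (haff : ∀ k < n, ∀ t ∈ Set.Icc (a k) (a (k + 1)),
      p t = p (a k) + (t - a k) • u k)
    (hangle : ∀ i, 0 < i → i < n →
      InnerProductGeometry.angle (p (a i) - p (a (i - 1))) (p (a (i + 1)) - p (a i))
        ≤ K * ((a i - a (i - 1)) + (a (i + 1) - a i)) / 2) :
    2 / K * Real.sin (K * L / 2) < ‖p L - p 0‖ := by
  have hsub : ∀ k < n, p (a (k + 1)) - p (a k) = (a (k + 1) - a k) • u k := fun k hk => by
    rw [haff k hk _ ⟨(hmono k hk).le, le_rfl⟩, add_sub_cancel_left]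
  have hmonoOn : ∀ j, j ≤ n → ∀ i ≤ j, a i ≤ a j := by
    intro j hj i hij
    induction j, hij using Nat.le_induction with
    | base => exact le_rfl
    | succ j _ ih => exact (ih (by omega)).trans (hmono j (by omega)).le
  have hnonneg : ∀ k ≤ n, 0 ≤ a k := fun k hk => ha0 ▸ hmonoOn k hk 0 (Nat.zero_le k)
  have hle : ∀ k ≤ n, a k ≤ L := fun k hk => han ▸ hmonoOn n le_rfl k hk
  set θ : ℕ → ℝ := fun k => (K * (a k - L / 2) + K * (a (k + 1) - L / 2)) / 2 with hθ
  have hstep : ∀ k, k + 1 < n →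
      InnerProductGeometry.angle (u k) (u (k + 1)) ≤ θ (k + 1) - θ k := by
    intro k hk
    have h := hangle (k + 1) k.succ_pos hk
    rw [Nat.add_sub_cancel, hsub k (by omega), hsub (k + 1) hk,
      InnerProductGeometry.angle_smul_left_of_pos _ _ (sub_pos.2 (hmono k (by omega))),
      InnerProductGeometry.angle_smul_right_of_pos _ _ (sub_pos.2 (hmono (k + 1) hk))] at h
    simp only [hθ]
    linarith
  have hne : ∀ k < n, u k ≠ 0 := fun k hk h => by simpa [h] using hu k hk
  have hpair : ∀ i < n, ∀ j < n, InnerProductGeometry.angle (u i) (u j) ≤ |θ i - θ j| := by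
    intro i hi j hj
    rcases le_total i j with hij | hij
    · rw [abs_sub_comm]
      exact (angle_le_sub_of_angle_succ_le hne hstep hij hj).trans (le_abs_self _)
    · rw [InnerProductGeometry.angle_comm]
      exact (angle_le_sub_of_angle_succ_le hne hstep hij hi).trans (le_abs_self _)
  have hlow : ∀ k ≤ n, -(Real.pi / 2) ≤ K * (a k - L / 2) := fun k hk => by
    nlinarith [mul_nonneg hK.le (hnonneg k hk)]
  have hup : ∀ k ≤ n, K * (a k - L / 2) ≤ Real.pi / 2 := fun k hk => by
    nlinarith [mul_le_mul_of_nonneg_left (hle k hk) hK.le]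
  have hpi : ∀ i < n, ∀ j < n, |θ i - θ j| ≤ Real.pi := by
    intro i hi j hj
    rw [abs_le]
    simp only [hθ]
    constructor <;>
      linarith [hlow i hi.le, hlow (i + 1) hi, hlow j hj.le, hlow (j + 1) hj,
        hup i hi.le, hup (i + 1) hi, hup j hj.le, hup (j + 1) hj]
  have hnorm := sum_mul_cos_le_norm_sum_smul (Finset.range n) (fun k => a (k + 1) - a k) θ u
    (fun k hk => (sub_pos.2 (hmono k (Finset.mem_range.1 hk))).le)
    (fun k hk => hu k (Finset.mem_range.1 hk))
    (fun i hi j hj => hpi i (Finset.mem_range.1 hi) j (Finset.mem_range.1 hj))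
    (fun i hi j hj => hpair i (Finset.mem_range.1 hi) j (Finset.mem_range.1 hj))
  have hchord : ∑ k ∈ Finset.range n, (a (k + 1) - a k) • u k = p L - p 0 := by
    rw [← Finset.sum_congr rfl fun k hk => hsub k (Finset.mem_range.1 hk),
      Finset.sum_range_sub (fun k => p (a k)), han, ha0]
  have hsum : ∑ k ∈ Finset.range n,
      (Real.sin (K * (a (k + 1) - L / 2)) - Real.sin (K * (a k - L / 2)))
      < ∑ k ∈ Finset.range n, K * ((a (k + 1) - a k) * Real.cos (θ k)) := by
    refine Finset.sum_lt_sum_of_nonempty (Finset.nonempty_range_iff.2 (by omega)) fun k hk => ?_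
    have hk' := Finset.mem_range.1 hk
    have h := sin_sub_sin_lt
      (mul_lt_mul_of_pos_left (sub_lt_sub_right (hmono k hk') (L / 2)) hK)
      (hlow k hk'.le) (hup (k + 1) hk')
    refine h.trans_eq ?_
    simp only [hθ]
    ring
  rw [Finset.sum_range_sub (fun k => Real.sin (K * (a k - L / 2))), ← Finset.mul_sum, han, ha0,
    show K * (0 - L / 2) = -(K * L / 2) by ring, show K * (L - L / 2) = K * L / 2 by ring,
    Real.sin_neg] at hsum
  rw [hchord] at hnorm
  refine lt_of_lt_of_le ?_ hnorm
  rw [div_mul_eq_mul_div, div_lt_iff₀ hK]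
  linarith
end

section
/- For all α, β ∈ [0, π/6], sin(α) + sin(β) ≤ 2 tan((α+β)/2). -/
/-- For all `α, β ∈ [0, π/6]` one has `sin α + sin β ≤ 2 * tan ((α + β) / 2)`. -/
theorem sin_add_sin_le_two_tan_half
    (α β : ℝ) (hα : α ∈ Set.Icc 0 (Real.pi / 6)) (hβ : β ∈ Set.Icc 0 (Real.pi / 6)) :
    Real.sin α + Real.sin β ≤ 2 * Real.tan ((α + β) / 2) := by
  obtain ⟨hα₀, hα₁⟩ := hα
  obtain ⟨hβ₀, hβ₁⟩ := hβ
  have htan : (α + β) / 2 ≤ Real.tan ((α + β) / 2) :=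
    Real.le_tan (by linarith) (by linarith [Real.pi_pos])
  linarith [Real.sin_le hα₀, Real.sin_le hβ₀]
end

section
/- For all α, β ∈ [0, π/6], 2 tan((α+β)/2) ≤ (1 + (α+β)²)·(sin(α) + sin(β)) whenever α + β > 0; equivalently, for α + β > 0 one has 0 ≤ 2 tan((α+β)/2)/(sin(α)+sin(β)) − 1 ≤ (α+β)². -/
/-- If `|d| ≤ s ≤ 3 / 4`, then `1 ≤ (1 + (2 s)²) * (cos s * cos d)`. -/
theorem one_le_one_add_sq_mul_cos_mul_cos {s d : ℝ} (hs : s ≤ 3 / 4) (hd : |d| ≤ s) :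
    1 ≤ (1 + (2 * s) ^ 2) * (Real.cos s * Real.cos d) := by
  have hs0 : 0 ≤ s := (abs_nonneg d).trans hd
  have hcos : 0 ≤ Real.cos s :=
    Real.cos_nonneg_of_mem_Icc ⟨by linarith [Real.pi_gt_three], by linarith [Real.pi_gt_three]⟩
  have hle : Real.cos s ≤ Real.cos d := by
    rw [← Real.cos_abs d]
    exact Real.cos_le_cos_of_nonneg_of_le_pi (abs_nonneg d) (by linarith [Real.pi_gt_three]) hd
  have hsin : Real.sin s ^ 2 ≤ s ^ 2 := sq_le_sq' (by
    linarith [Real.sin_nonneg_of_nonneg_of_le_pi hs0 (by linarith [Real.pi_gt_three])])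
    (Real.sin_le hs0)
  have hprod : 1 - s ^ 2 ≤ Real.cos s * Real.cos d := by
    nlinarith [mul_le_mul_of_nonneg_left hle hcos, Real.sin_sq_add_cos_sq s]
  calc (1 : ℝ) ≤ (1 + (2 * s) ^ 2) * (1 - s ^ 2) := by
        have hsq : s ^ 2 ≤ 3 / 4 := by nlinarith
        nlinarith [mul_nonneg (sq_nonneg s) (sub_nonneg.2 hsq)]
    _ ≤ _ := by gcongr


/-- For all `α, β ∈ [0, π/6]` with `α + β > 0` one has
`2 * tan ((α + β) / 2) ≤ (1 + (α + β)²) * (sin α + sin β)`; equivalently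
`0 ≤ 2 * tan ((α + β) / 2) / (sin α + sin β) - 1 ≤ (α + β)²`. -/
theorem two_tan_half_le_one_add_sq_mul_sin_add_sin
    (α β : ℝ) (hα : α ∈ Set.Icc 0 (Real.pi / 6)) (hβ : β ∈ Set.Icc 0 (Real.pi / 6))
    (hpos : 0 < α + β) :
    2 * Real.tan ((α + β) / 2) ≤ (1 + (α + β) ^ 2) * (Real.sin α + Real.sin β) ∧
    0 ≤ 2 * Real.tan ((α + β) / 2) / (Real.sin α + Real.sin β) - 1 ∧
    2 * Real.tan ((α + β) / 2) / (Real.sin α + Real.sin β) - 1 ≤ (α + β) ^ 2 := by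
  obtain ⟨hα0, hα1⟩ := hα
  obtain ⟨hβ0, hβ1⟩ := hβ
  have hpi := Real.pi_gt_three
  have hpi' := Real.pi_lt_four
  obtain ⟨s, hs⟩ : ∃ s, s = (α + β) / 2 := ⟨_, rfl⟩
  obtain ⟨d, hd⟩ : ∃ d, d = (α - β) / 2 := ⟨_, rfl⟩
  have hsum : α + β = 2 * s := by linarith
  have hds : |d| ≤ s := abs_le.2 ⟨by linarith, by linarith⟩
  have hsin : 0 < Real.sin s := Real.sin_pos_of_pos_of_lt_pi (by linarith) (by linarith)
  have hcs : 0 < Real.cos s := Real.cos_pos_of_mem_Ioo ⟨by linarith, by linarith⟩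
  have hcd : 0 < Real.cos d := Real.cos_pos_of_mem_Ioo ⟨by linarith, by linarith⟩
  have hadd : Real.sin α + Real.sin β = 2 * (Real.sin s * Real.cos d) := by
    rw [show α = s + d by linarith, show β = s - d by linarith, Real.sin_add, Real.sin_sub]
    ring
  have hden : 0 < Real.sin α + Real.sin β := by rw [hadd]; positivity
  have htan : 2 * Real.tan ((α + β) / 2) * (Real.cos s * Real.cos d) =
      Real.sin α + Real.sin β := by
    rw [← hs, hadd, Real.tan_eq_sin_div_cos]
    field_simp
  have htan0 : 0 ≤ 2 * Real.tan ((α + β) / 2) := by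
    rw [← hs, Real.tan_eq_sin_div_cos]
    positivity
  have hupper : 2 * Real.tan ((α + β) / 2) ≤
      (1 + (α + β) ^ 2) * (Real.sin α + Real.sin β) := by
    have hcos := one_le_one_add_sq_mul_cos_mul_cos (by linarith) hds
    rw [← hsum] at hcos
    rw [← htan]
    linarith [mul_le_mul_of_nonneg_left hcos htan0]
  refine ⟨hupper, ?_, ?_⟩
  · rw [sub_nonneg, one_le_div hden, ← htan]
    exact mul_le_of_le_one_right htan0
      (mul_le_one₀ (Real.cos_le_one s) hcd.le (Real.cos_le_one d))
  · rw [sub_le_iff_le_add', div_le_iff₀ hden]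
    exact hupper
end

section
/- Let x, y, z be three distinct, non-collinear points in ℝ^d (d ≥ 2), let φ ∈ [0, π) be the angle ∠(y − x, z − y), and let r = r(x,y,z) be the circumradius of the triangle with vertices x, y, z. Then the discrete curvature satisfies κ_d(x,y,z) := 4 tan(φ/2)/(|x−y| + |z−y|) ≥ 1/r. -/
/-- **Discrete curvature bounds the inverse circumradius** (the inequality
`κ_d(x, y, z) ≥ 1/r(x, y, z)` used in Step 1 of the proof of the limsup inequality).
Let `x, y, z` be three distinct, non-collinear points in `ℝ^d` (`d ≥ 2`), let
`φ = ∠(y - x, z - y)` be the exterior angle at `y`, and let `r` be the circumradius of the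
triangle `x y z`, i.e. the common distance of `x, y, z` to the circumcenter `o`, the unique
point of the affine plane spanned by `x, y, z` equidistant from them.  Then
`κ_d(x, y, z) = 4 * tan (φ/2) / (|x - y| + |z - y|) ≥ 1/r`. -/
theorem discrete_curvature_ge_inv_circumradius
    (d : ℕ) (hd : 2 ≤ d) (x y z : EuclideanSpace ℝ (Fin d))
    (hxy : x ≠ y) (hyz : y ≠ z) (hxz : x ≠ z)
    (hncol : ¬ Collinear ℝ ({x, y, z} : Set (EuclideanSpace ℝ (Fin d))))
    (o : EuclideanSpace ℝ (Fin d)) (r : ℝ)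
    (ho : o ∈ affineSpan ℝ ({x, y, z} : Set (EuclideanSpace ℝ (Fin d))))
    (hox : dist o x = r) (hoy : dist o y = r) (hoz : dist o z = r) :
    1 / r ≤ 4 * Real.tan (InnerProductGeometry.angle (y - x) (z - y) / 2) /
      (‖x - y‖ + ‖z - y‖) := by
  have hind : AffineIndependent ℝ ![x, y, z] :=
    affineIndependent_iff_not_collinear_set.mpr hncol
  let t : Affine.Triangle ℝ (EuclideanSpace ℝ (Fin d)) := ⟨![x, y, z], hind⟩
  have hrange : Set.range t.points = {x, y, z} := by
    change Set.range ![x, y, z] = _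
    simp [Matrix.range_cons, Set.insert_def, Set.union_def]
  have hR : r = t.circumradius := by
    refine t.eq_circumradius_of_dist_eq (p := o) (by rwa [hrange]) fun i => ?_
    fin_cases i
    · simpa [t, dist_comm] using hox
    · simpa [t, dist_comm] using hoy
    · simpa [t, dist_comm] using hoz
  have hr : 0 < r := hR ▸ t.circumradius_pos
  have hsine : dist x z / Real.sin (EuclideanGeometry.angle x y z) = 2 * r := by
    rw [hR]
    exact t.dist_div_sin_angle_eq_two_mul_circumradius (i₁ := 0) (i₂ := 1) (i₃ := 2)
      (by decide) (by decide) (by decide)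
  set φ := InnerProductGeometry.angle (y - x) (z - y) with hφ
  have hext : EuclideanGeometry.angle x y z = Real.pi - φ := by
    rw [hφ, ← InnerProductGeometry.angle_neg_left, neg_sub]
    rfl
  rw [hext, Real.sin_pi_sub] at hsine
  have hxz' : 0 < dist x z := dist_pos.mpr hxz
  have hsin_ne : Real.sin φ ≠ 0 := by
    intro h
    rw [h, div_zero] at hsine
    linarith
  have hφ_nonneg : 0 ≤ φ := InnerProductGeometry.angle_nonneg _ _
  have hφ_lt : φ < Real.pi := by
    refine lt_of_le_of_ne (InnerProductGeometry.angle_le_pi _ _) fun h => hsin_ne ?_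
    rw [h, Real.sin_pi]
  have hcos : 0 < Real.cos (φ / 2) :=
    Real.cos_pos_of_mem_Ioo ⟨by linarith [Real.pi_pos], by linarith⟩
  have hsin : 0 ≤ Real.sin (φ / 2) :=
    Real.sin_nonneg_of_nonneg_of_le_pi (by linarith) (by linarith)
  have hchord : dist x z = 4 * r * Real.sin (φ / 2) * Real.cos (φ / 2) := by
    have h2 : Real.sin φ = 2 * Real.sin (φ / 2) * Real.cos (φ / 2) := by
      rw [← Real.sin_two_mul]; ring_nf
    rw [div_eq_iff hsin_ne, h2] at hsine
    rw [hsine]; ring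
  have hlaw : dist x z ^ 2 =
      ‖x - y‖ ^ 2 + 2 * (‖x - y‖ * ‖z - y‖ * Real.cos φ) + ‖z - y‖ ^ 2 := by
    have h := norm_add_sq_real (y - x) (z - y)
    rw [← InnerProductGeometry.cos_angle_mul_norm_mul_norm, ← hφ, norm_sub_rev y x] at h
    rw [dist_comm, dist_eq_norm, show z - x = (y - x) + (z - y) by abel, h]
    ring
  have hcosφ : Real.cos φ = 2 * Real.cos (φ / 2) ^ 2 - 1 := by
    rw [← Real.cos_two_mul]; ring_nf
  have hsum : (‖x - y‖ + ‖z - y‖) * Real.cos (φ / 2) ≤ dist x z := by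
    refine abs_le_of_sq_le_sq' ?_ hxz'.le |>.2
    rw [hlaw, hcosφ]
    nlinarith [mul_nonneg (sq_nonneg (‖x - y‖ - ‖z - y‖))
      (sub_nonneg.mpr (Real.cos_sq_le_one (φ / 2)))]
  have hbound : ‖x - y‖ + ‖z - y‖ ≤ 4 * r * Real.sin (φ / 2) := by
    rw [hchord] at hsum
    exact le_of_mul_le_mul_right hsum hcos
  have htan : Real.sin (φ / 2) ≤ Real.tan (φ / 2) := by
    rw [Real.tan_eq_sin_div_cos]
    exact le_div_self hsin hcos (Real.cos_le_one _)
  have hlen : 0 < ‖x - y‖ + ‖z - y‖ :=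
    add_pos_of_pos_of_nonneg (norm_pos_iff.mpr (sub_ne_zero.mpr hxy)) (norm_nonneg _)
  rw [div_le_div_iff₀ hr hlen]
  nlinarith [mul_le_mul_of_nonneg_left htan hr.le]
end
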